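/- With the data of the free field construction of W_{q,t}(A(M,N)) as in the context, for every nonzero integer m, every 1 ≤ i ≤ L+1 and every 1 ≤ j ≤ L, one has Σ_{k=1}^{L} λ_{i,k}(m) · A_{k,j}(m) · s_j(−m) = q_{i,j}^m − p_{i,j}^m; in particular the left-hand side vanishes whenever i ∉ {j, j+1}. (This states that the explicit coefficients (3.14)–(3.15) of Theorem 3.1 solve the mutual-locality linear system (3.18) of Lemma 3.5.) -/

import Mathlib

/-- The q-integer `[n]_x = (x^n - x^{-n})/(x - x^{-1})`, with real powers of `x`. -/
noncomputable def qint (x n : ℝ) : ℝ := (x ^ n - x ^ (-n)) / (x - x⁻¹)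

/-- The quantity `σ_j(m)` from Theorem 3.1 (1-based index `j`, real `m`). -/
noncomputable def sigmaj (x r : ℝ) (m : ℝ) (ε : ℕ → Bool) (j : ℕ) : ℝ :=
  if ε j ≠ ε (j + 1) then -1
  else if ε (j + 1) then
    -(qint x m * qint x (2 * (r - 1) * m)) / (qint x (r * m) * qint x ((r - 1) * m))
  else -(qint x ((r - 1) * m) * qint x (2 * m)) / (qint x (r * m) * qint x m)

/-- `s_j(m)`: equal to `1` for `m > 0` and to `σ_j(-m)` for `m < 0`. -/
noncomputable def sfun (x r : ℝ) (ε : ℕ → Bool) (j : ℕ) (m : ℤ) : ℝ :=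
  if 0 < m then 1 else sigmaj x r (-(m : ℝ)) ε j

/-- The quantity `γ_j(m)`: `[m]_x` if `ε_j = 1` and `[(r-1)m]_x` if `ε_j = 0`. -/
noncomputable def gamj (x r : ℝ) (m : ℝ) (ε : ℕ → Bool) (j : ℕ) : ℝ :=
  if ε j then qint x m else qint x ((r - 1) * m)

/-- The entry `A_{k,l}(m)` (1-based indices) of the tridiagonal matrix `A(m)`, `m > 0`. -/
noncomputable def Ament (x r : ℝ) (m : ℝ) (ε : ℕ → Bool) (k l : ℕ) : ℝ :=
  if k = l then 1
  else if l = k + 1 then gamj x r m ε l / (qint x (r * m) * sigmaj x r m ε l)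
  else if k = l + 1 then gamj x r m ε k / (qint x (r * m) * sigmaj x r m ε l)
  else 0

/-- The entry `A_{k,l}(m)` for a nonzero integer `m`; for `m < 0`, `A(m)` is the
transpose of `A(-m)`. -/
noncomputable def AentZ (x r : ℝ) (ε : ℕ → Bool) (m : ℤ) (k l : ℕ) : ℝ :=
  if 0 < m then Ament x r (m : ℝ) ε k l else Ament x r (-(m : ℝ)) ε l k

/-- `d_j = r - 1` if `ε_j = 1` and `d_j = 1` if `ε_j = 0`. -/
noncomputable def dfun (r : ℝ) (ε : ℕ → Bool) (j : ℕ) : ℝ := if ε j then r - 1 else 1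

/-- `D(k,l) = Σ_{j=k+1}^{l+1} d_j` (and `D(k,l) = 0` for `k > l`). -/
noncomputable def Dfun (r : ℝ) (ε : ℕ → Bool) (k l : ℕ) : ℝ :=
  ∑ j ∈ Finset.Icc (k + 1) (l + 1), dfun r ε j

/-- The coefficient `λ_{i,j}(m)` of Theorem 3.1 (formula (3.14)), for nonzero `m : ℤ`,
`1 ≤ i ≤ L+1`, `1 ≤ j ≤ L`; here `a = D(0,L)`. -/
noncomputable def lamZ (L : ℕ) (x r : ℝ) (ε : ℕ → Bool) (i j : ℕ) (m : ℤ) : ℝ :=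
  sfun x r ε j m * (qint x (r * m) * (x - x⁻¹) / qint x (Dfun r ε 0 L * m)) *
    (if j < i then -(x ^ ((r + Dfun r ε 1 L) * m)) * qint x (Dfun r ε 0 (j - 1) * m)
     else x ^ ((r - Dfun r ε 0 0) * m) * qint x (Dfun r ε j L * m))

/-- The parameter `q_{i,j}` of Theorem 3.1 (nontrivial only for `i ∈ {j, j+1}`;
for other `i` one has `q_{i,j} = p_{i,j}`, here both normalized to `1`). -/
noncomputable def qijD (x r : ℝ) (ε : ℕ → Bool) (i j : ℕ) : ℝ :=
  if i = j then x ^ Dfun r ε 1 (j - 1)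
  else if i = j + 1 then x ^ (2 * r + Dfun r ε 1 (j - 1))
  else 1

/-- The parameter `p_{i,j}` of Theorem 3.1 (nontrivial only for `i ∈ {j, j+1}`;
for other `i` one has `p_{i,j} = q_{i,j}`, here both normalized to `1`). -/
noncomputable def pijD (x r : ℝ) (ε : ℕ → Bool) (i j : ℕ) : ℝ :=
  if i = j then
    (if j = 1 then (if ε 1 then x ^ (2 : ℝ) else x ^ (2 * r - 2))
     else x ^ Dfun r ε 1 (j - 2) * (if ε j then x ^ (r + 1) else x ^ (2 * r - 1)))
  else if i = j + 1 then
    x ^ Dfun r ε 1 (j - 1) * (if ε (j + 1) then x ^ (2 * r - 2) else x ^ (2 : ℝ))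
  else 1

open Finset in
/-- A sum over `1, …, L` against a tridiagonal kernel collapses to three terms when the
summand vanishes at `0` and `L + 1`. -/
theorem sum_Icc_mul_tridiagonal {R : Type*} [CommRing R] (g : ℕ → R) (L i : ℕ) (hi : i + 1 ≤ L)
    (h0 : g 0 = 0) (hL : g (L + 1) = 0) (u v w : R) :
    ∑ k ∈ Icc 1 L, g k *
        (if k = i + 1 then v else if k = i then u else if k = i + 2 then w else 0) =
      g i * u + g (i + 1) * v + g (i + 2) * w := by
  have hsub : Icc 1 L ⊆ range (L + 2) := fun k hk => by
    simp only [mem_Icc, mem_range] at *; omega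
  rw [sum_subset hsub]
  · have hterm : ∀ k ∈ range (L + 2), g k *
        (if k = i + 1 then v else if k = i then u else if k = i + 2 then w else 0) =
        (if k = i then g i * u else 0) + (if k = i + 1 then g (i + 1) * v else 0) +
          (if k = i + 2 then g (i + 2) * w else 0) := fun k _ => by
      by_cases h1 : k = i + 1
      · subst h1; simp
      by_cases h2 : k = i
      · subst h2; simp
      by_cases h3 : k = i + 2
      · subst h3; simp
      simp [h1, h2, h3]
    rw [sum_congr rfl hterm, sum_add_distrib, sum_add_distrib]
    simp only [sum_ite_eq', mem_range]
    rw [if_pos (by omega), if_pos (by omega), if_pos (by omega)]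
  · intro k hk hk'
    simp only [mem_Icc, mem_range] at *
    have : k = 0 ∨ k = L + 1 := by omega
    rcases this with rfl | rfl
    · rw [h0, zero_mul]
    · rw [hL, zero_mul]

theorem sub_inv_ne_zero {x : ℝ} (hx0 : 0 < x) (hx1 : x < 1) : x - x⁻¹ ≠ 0 := by
  have : 1 < x⁻¹ := (one_lt_inv₀ hx0).2 hx1
  linarith

theorem qint_zero (x : ℝ) : qint x 0 = 0 := by simp [qint]

theorem qint_neg (x t : ℝ) : qint x (-t) = -qint x t := by
  simp only [qint, neg_neg]; ring

theorem qint_mul_sub_inv {x : ℝ} (hx0 : 0 < x) (hx1 : x < 1) (t : ℝ) :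
    qint x t * (x - x⁻¹) = x ^ t - x ^ (-t) :=
  div_mul_cancel₀ _ (sub_inv_ne_zero hx0 hx1)

theorem qint_ne_zero {x t : ℝ} (hx0 : 0 < x) (hx1 : x < 1) (ht : t ≠ 0) : qint x t ≠ 0 := by
  refine div_ne_zero (sub_ne_zero.2 fun h => ht ?_) (sub_inv_ne_zero hx0 hx1)
  have := (Real.rpow_right_inj hx0 hx1.ne).1 h
  linarith

theorem qint_add {x : ℝ} (hx0 : 0 < x) (u v : ℝ) :
    qint x (u + v) = qint x u * x ^ (-v) + qint x v * x ^ u := by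
  simp only [qint, neg_add, Real.rpow_add hx0]; ring

theorem qint_two_mul {x : ℝ} (hx0 : 0 < x) (u : ℝ) :
    qint x (2 * u) = qint x u * (x ^ (-u) + x ^ u) := by
  rw [two_mul, qint_add hx0]; ring

theorem gamj_eq (x r m : ℝ) (ε : ℕ → Bool) (j : ℕ) :
    gamj x r m ε j = qint x ((r - dfun r ε j) * m) := by
  unfold gamj dfun
  split_ifs
  · congr 1; ring
  · rfl

theorem gamj_neg (x r m : ℝ) (ε : ℕ → Bool) (j : ℕ) :
    gamj x r (-m) ε j = -gamj x r m ε j := by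
  rw [gamj_eq, gamj_eq, mul_neg, qint_neg]

theorem sigmaj_neg (x r m : ℝ) (ε : ℕ → Bool) (j : ℕ) :
    sigmaj x r (-m) ε j = sigmaj x r m ε j := by
  simp only [sigmaj, mul_neg, qint_neg, neg_mul, neg_neg]

theorem dfun_pos {r : ℝ} (hr : 1 < r) (ε : ℕ → Bool) (j : ℕ) : 0 < dfun r ε j := by
  unfold dfun; split_ifs <;> linarith

theorem sigmaj_ne_zero {x r m : ℝ} (hr : 1 < r) (hx0 : 0 < x) (hx1 : x < 1) (hm : m ≠ 0)
    (ε : ℕ → Bool) (j : ℕ) : sigmaj x r m ε j ≠ 0 := by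
  have hq : ∀ t : ℝ, 0 < t → qint x (t * m) ≠ 0 := fun t ht =>
    qint_ne_zero hx0 hx1 (mul_ne_zero ht.ne' hm)
  have h1 : qint x m ≠ 0 := qint_ne_zero hx0 hx1 hm
  have h2 := hq r (by linarith)
  have h3 := hq (r - 1) (by linarith)
  have h4 := hq 2 (by norm_num)
  have h5 := hq (2 * (r - 1)) (by linarith)
  unfold sigmaj
  split_ifs
  · norm_num
  · exact div_ne_zero (neg_ne_zero.2 (mul_ne_zero h1 h5)) (mul_ne_zero h2 h3)
  · exact div_ne_zero (neg_ne_zero.2 (mul_ne_zero h3 h4)) (mul_ne_zero h2 h1)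

/-- The local relation behind the linear recurrence satisfied by `k ↦ x ^ (D(0, k - 1) m)`. -/
theorem gamj_mul_rpow_add {x r m : ℝ} (hr : 1 < r) (hx0 : 0 < x) (hx1 : x < 1) (hm : m ≠ 0)
    (ε : ℕ → Bool) (j : ℕ) :
    gamj x r m ε j * x ^ (-(dfun r ε j * m)) + gamj x r m ε (j + 1) * x ^ (dfun r ε (j + 1) * m)
      = -(qint x (r * m) * sigmaj x r m ε j) := by
  have h1 : qint x m ≠ 0 := qint_ne_zero hx0 hx1 hm
  have h2 : qint x (r * m) ≠ 0 := qint_ne_zero hx0 hx1 (mul_ne_zero (by linarith) hm)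
  have h3 : qint x ((r - 1) * m) ≠ 0 := qint_ne_zero hx0 hx1 (mul_ne_zero (by linarith) hm)
  have h5 : qint x (2 * (r - 1) * m) =
      qint x ((r - 1) * m) * (x ^ (-((r - 1) * m)) + x ^ ((r - 1) * m)) := by
    rw [← qint_two_mul hx0, mul_assoc]
  have h4 := qint_two_mul hx0 m
  have h6 : qint x (r * m) =
      qint x m * x ^ (-((r - 1) * m)) + qint x ((r - 1) * m) * x ^ m := by
    rw [← qint_add hx0]; congr 1; ring
  have h7 : qint x (r * m) =
      qint x ((r - 1) * m) * x ^ (-m) + qint x m * x ^ ((r - 1) * m) := by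
    rw [← qint_add hx0]; congr 1; ring
  cases ha : ε j <;> cases hb : ε (j + 1) <;>
    simp [gamj, sigmaj, dfun, ha, hb]
  · rw [h4]; field_simp
  · rw [h7]
  · rw [h6]
  · rw [h5]; field_simp

/-- The linear recurrence satisfied by `t ↦ [t]_x` along the steps `d_j m`, `d_{j+1} m`. -/
theorem gamj_mul_qint_add {x r m : ℝ} (hr : 1 < r) (hx0 : 0 < x) (hx1 : x < 1) (hm : m ≠ 0)
    (ε : ℕ → Bool) (j : ℕ) (t : ℝ) :
    gamj x r m ε j * qint x (t - dfun r ε j * m) + qint x (r * m) * sigmaj x r m ε j * qint x t +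
      gamj x r m ε (j + 1) * qint x (t + dfun r ε (j + 1) * m) = 0 := by
  have h1 := gamj_mul_rpow_add hr hx0 hx1 hm ε j
  have h2 := gamj_mul_rpow_add hr hx0 hx1 (neg_ne_zero.2 hm) ε j
  simp only [gamj_neg, sigmaj_neg, mul_neg, qint_neg, neg_neg] at h2
  have e1 : -(t - dfun r ε j * m) = -t + dfun r ε j * m := by ring
  have e2 : -(t + dfun r ε (j + 1) * m) = -t + -(dfun r ε (j + 1) * m) := by ring
  simp only [qint] at *
  rw [e1, e2, sub_eq_add_neg t]
  simp only [Real.rpow_add hx0]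
  linear_combination (x ^ t / (x - x⁻¹)) * h1 + (x ^ (-t) / (x - x⁻¹)) * h2

/-- The kernel `s_k(m) A_{k,j}(m) s_j(-m)`, in a form that does not depend on the sign of `m`. -/
theorem sfun_mul_AentZ_mul_sfun {x r : ℝ} (hr : 1 < r) (hx0 : 0 < x) (hx1 : x < 1) {m : ℤ}
    (hm : m ≠ 0) (ε : ℕ → Bool) (k i : ℕ) :
    sfun x r ε k m * AentZ x r ε m k (i + 1) * sfun x r ε (i + 1) (-m) =
      if k = i + 1 then sigmaj x r m ε (i + 1)
      else if k = i then gamj x r m ε (i + 1) / qint x (r * m)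
      else if k = i + 2 then gamj x r m ε (i + 2) / qint x (r * m) else 0 := by
  have hm' : (m : ℝ) ≠ 0 := Int.cast_ne_zero.2 hm
  have hq : qint x (r * m) ≠ 0 := qint_ne_zero hx0 hx1 (mul_ne_zero (by linarith) hm')
  have hs := sigmaj_ne_zero hr hx0 hx1 hm' ε
  have hsk := hs k
  have hsi := hs (i + 1)
  rcases lt_or_gt_of_ne hm with h | h
  · have h1 : ¬ 0 < m := by omega
    have h2 : 0 < -m := by omega
    simp only [sfun, AentZ, Ament, if_neg h1, if_pos h2, sigmaj_neg, gamj_neg, mul_neg, qint_neg,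
      mul_one]
    by_cases c1 : k = i + 1
    · simp [c1]
    by_cases c2 : k = i
    · subst c2
      have c3 : ¬ k = k + 1 + 1 := by omega
      simp [c3]
      field_simp
    by_cases c3 : k = i + 2
    · subst c3; simp; field_simp
    have c4 : ¬ i + 1 = k := fun h => c1 h.symm
    simp [c1, c2, c3, c4, Ne.symm c2]
  · have h2 : ¬ 0 < -m := by omega
    simp only [sfun, AentZ, Ament, if_neg h2, if_pos h, Int.cast_neg, neg_neg, one_mul]
    by_cases c1 : k = i + 1
    · simp [c1]
    by_cases c2 : k = i
    · subst c2; simp; field_simp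
    by_cases c3 : k = i + 2
    · subst c3; simp; field_simp
    simp [c1, c2, c3, Ne.symm c2]

/-- The partial sum `d_1 + ⋯ + d_k`. -/
noncomputable def dsum (r : ℝ) (ε : ℕ → Bool) (k : ℕ) : ℝ :=
  ∑ j ∈ Finset.Icc 1 k, dfun r ε j

theorem dsum_zero (r : ℝ) (ε : ℕ → Bool) : dsum r ε 0 = 0 := by simp [dsum]

theorem dsum_succ (r : ℝ) (ε : ℕ → Bool) (k : ℕ) :
    dsum r ε (k + 1) = dsum r ε k + dfun r ε (k + 1) :=
  Finset.sum_Icc_succ_top (by omega) _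

theorem dsum_pos {r : ℝ} (hr : 1 < r) (ε : ℕ → Bool) (k : ℕ) : 0 < dsum r ε (k + 1) :=
  Finset.sum_pos (fun j _ => dfun_pos hr ε j) ⟨1, by simp⟩

theorem Dfun_eq (r : ℝ) (ε : ℕ → Bool) {k l : ℕ} (h : k ≤ l + 1) :
    Dfun r ε k l = dsum r ε (l + 1) - dsum r ε k := by
  obtain ⟨n, hn⟩ := Nat.exists_eq_add_of_le h
  unfold Dfun
  rw [hn]
  clear h hn
  induction n with
  | zero => simp
  | succ n ih =>
    rw [← add_assoc, Finset.sum_Icc_succ_top (by omega), ih, dsum_succ]; ring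

/-- The factor of `λ_{i,k}(m)` that depends on `i`, extended to all `k : ℕ`. -/
noncomputable def lamCore (L : ℕ) (x r : ℝ) (ε : ℕ → Bool) (m : ℝ) (i k : ℕ) : ℝ :=
  if k < i then -(x ^ ((r + dsum r ε (L + 1) - dfun r ε 1) * m)) * qint x (dsum r ε k * m)
  else x ^ ((r - dfun r ε 1) * m) * qint x ((dsum r ε (L + 1) - dsum r ε k) * m)

theorem dsum_one (r : ℝ) (ε : ℕ → Bool) : dsum r ε 1 = dfun r ε 1 := by simp [dsum]

theorem lamZ_eq (L : ℕ) (x r : ℝ) (ε : ℕ → Bool) (i k : ℕ) (m : ℤ) (hk : 1 ≤ k)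
    (hkL : k ≤ L) :
    lamZ L x r ε i k m =
      (qint x (r * m) * (x - x⁻¹) / qint x (dsum r ε (L + 1) * m)) * lamCore L x r ε m i k *
        sfun x r ε k m := by
  obtain ⟨k, rfl⟩ := Nat.exists_eq_add_of_le' hk
  unfold lamZ lamCore
  rw [Dfun_eq r ε (Nat.zero_le (L + 1)), Dfun_eq r ε (by omega : 1 ≤ L + 1),
    Dfun_eq r ε (by omega : 0 ≤ k + 1 - 1 + 1), Dfun_eq r ε (by omega : 0 ≤ 0 + 1),
    Dfun_eq r ε (by omega : k + 1 ≤ L + 1)]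
  simp only [dsum_zero, dsum_one, sub_zero, zero_add, Nat.add_sub_cancel, ← add_sub_assoc]
  ring

/-- The two branches of `lamCore` differ by a pure power of `x`. -/
theorem rpow_mul_qint_add {x : ℝ} (hx0 : 0 < x) (a b s m : ℝ) :
    x ^ (b * m) * qint x ((a - s) * m) + x ^ ((b + a) * m) * qint x (s * m) =
      x ^ ((b + s) * m) * qint x (a * m) := by
  have e1 : (a - s) * m = a * m + -(s * m) := by ring
  have e2 : -(a * m + -(s * m)) = -(a * m) + s * m := by ring
  simp only [qint, add_mul, e1, e2, Real.rpow_add hx0, Real.rpow_neg hx0.le]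
  have h1 := (Real.rpow_pos_of_pos hx0 (a * m)).ne'
  have h2 := (Real.rpow_pos_of_pos hx0 (s * m)).ne'
  field_simp
  ring

theorem sum_lamZ_mul_AentZ {L : ℕ} {r x : ℝ} (hr : 1 < r) (hx0 : 0 < x) (hx1 : x < 1)
    (ε : ℕ → Bool) {m : ℤ} (hm : m ≠ 0) {i j : ℕ} (hi : 1 ≤ i) (hiL : i ≤ L + 1)
    (hjL : j + 1 ≤ L) :
    ∑ k ∈ Finset.Icc 1 L,
        lamZ L x r ε i k m * AentZ x r ε m k (j + 1) * sfun x r ε (j + 1) (-m) =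
      (x - x⁻¹) / qint x (dsum r ε (L + 1) * m) *
        (gamj x r m ε (j + 1) * lamCore L x r ε m i j +
          qint x (r * m) * sigmaj x r m ε (j + 1) * lamCore L x r ε m i (j + 1) +
          gamj x r m ε (j + 2) * lamCore L x r ε m i (j + 2)) := by
  have hm' : (m : ℝ) ≠ 0 := Int.cast_ne_zero.2 hm
  have hq : qint x (r * m) ≠ 0 := qint_ne_zero hx0 hx1 (mul_ne_zero (by linarith) hm')
  have hterm : ∀ k ∈ Finset.Icc 1 L,
      lamZ L x r ε i k m * AentZ x r ε m k (j + 1) * sfun x r ε (j + 1) (-m) =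
        (qint x (r * m) * (x - x⁻¹) / qint x (dsum r ε (L + 1) * m)) *
          (lamCore L x r ε m i k *
          (if k = j + 1 then sigmaj x r m ε (j + 1)
            else if k = j then gamj x r m ε (j + 1) / qint x (r * m)
            else if k = j + 2 then gamj x r m ε (j + 2) / qint x (r * m) else 0)) := by
    intro k hk
    rw [Finset.mem_Icc] at hk
    rw [← sfun_mul_AentZ_mul_sfun hr hx0 hx1 hm, lamZ_eq L x r ε i k m hk.1 hk.2]
    ring
  have h0 : lamCore L x r ε m i 0 = 0 := by
    rw [lamCore, if_pos (by omega), dsum_zero, zero_mul, qint_zero, mul_zero]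
  have hL : lamCore L x r ε m i (L + 1) = 0 := by
    rw [lamCore, if_neg (by omega), sub_self, zero_mul, qint_zero, mul_zero]
  rw [Finset.sum_congr rfl hterm, ← Finset.mul_sum, sum_Icc_mul_tridiagonal _ _ _ hjL h0 hL]
  field_simp

theorem qijD_zpow_sub_pijD_zpow_self {r x : ℝ} (hx0 : 0 < x) (ε : ℕ → Bool) (m : ℤ) (j : ℕ) :
    qijD x r ε (j + 1) (j + 1) ^ m - pijD x r ε (j + 1) (j + 1) ^ m =
      x ^ ((dsum r ε (j + 1) - dfun r ε 1) * m) -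
        x ^ ((2 * r - dfun r ε (j + 1) + dsum r ε j - dfun r ε 1) * m) := by
  have hq : qijD x r ε (j + 1) (j + 1) = x ^ (dsum r ε (j + 1) - dfun r ε 1) := by
    simp [qijD, Dfun_eq r ε (by omega : 1 ≤ j + 1), dsum_one]
  have hp : pijD x r ε (j + 1) (j + 1) =
      x ^ (2 * r - dfun r ε (j + 1) + dsum r ε j - dfun r ε 1) := by
    rcases j with _ | j
    · cases h : ε 1 <;> simp only [pijD, dfun, h, dsum_zero] <;> norm_num <;>
        · try rw [← Real.rpow_natCast]
          congr 1
          push_cast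
          ring
    · have hD : Dfun r ε 1 (j + 1 + 1 - 2) = dsum r ε (j + 1) - dfun r ε 1 := by
        rw [Dfun_eq r ε (by omega), dsum_one]; rfl
      simp only [pijD, hD]
      cases h : ε (j + 1 + 1) <;> simp [← Real.rpow_add hx0] <;> congr 1 <;>
        rw [show dfun r ε (j + 1 + 1) = _ from by rw [dfun, h]] <;> simp <;> ring
  rw [hq, hp, ← Real.rpow_intCast, ← Real.rpow_intCast, ← Real.rpow_mul hx0.le,
    ← Real.rpow_mul hx0.le]

theorem qijD_zpow_sub_pijD_zpow_succ {r x : ℝ} (hx0 : 0 < x) (ε : ℕ → Bool) (m : ℤ) (j : ℕ) :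
    qijD x r ε (j + 2) (j + 1) ^ m - pijD x r ε (j + 2) (j + 1) ^ m =
      x ^ ((2 * r + dsum r ε (j + 1) - dfun r ε 1) * m) -
        x ^ ((dsum r ε (j + 1) - dfun r ε 1 + 2 * dfun r ε (j + 2)) * m) := by
  have hD : Dfun r ε 1 (j + 1 - 1) = dsum r ε (j + 1) - dfun r ε 1 := by
    rw [Dfun_eq r ε (by omega), dsum_one]; rfl
  have hq : qijD x r ε (j + 2) (j + 1) = x ^ (2 * r + dsum r ε (j + 1) - dfun r ε 1) := by
    simp only [qijD, hD]; simp; congr 1; ring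
  have hp : pijD x r ε (j + 2) (j + 1) =
      x ^ (dsum r ε (j + 1) - dfun r ε 1 + 2 * dfun r ε (j + 2)) := by
    have h2 : (if ε (j + 1 + 1) then x ^ (2 * r - 2) else x ^ (2 : ℝ)) =
        x ^ (2 * dfun r ε (j + 2)) := by
      unfold dfun
      split_ifs <;> congr 1 <;> ring
    simp only [pijD, hD, h2]
    simp [Real.rpow_add hx0]
  rw [hq, hp, ← Real.rpow_intCast, ← Real.rpow_intCast, ← Real.rpow_mul hx0.le,
    ← Real.rpow_mul hx0.le]

theorem sum_lamZ_mul_AentZ_eq {L : ℕ} {r x : ℝ} (hr : 1 < r) (hx0 : 0 < x) (hx1 : x < 1)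
    (ε : ℕ → Bool) {m : ℤ} (hm : m ≠ 0) {i j : ℕ} (hi : 1 ≤ i) (hiL : i ≤ L + 1)
    (hj : 1 ≤ j) (hjL : j ≤ L) :
    ∑ k ∈ Finset.Icc 1 L, lamZ L x r ε i k m * AentZ x r ε m k j * sfun x r ε j (-m) =
      qijD x r ε i j ^ m - pijD x r ε i j ^ m := by
  obtain ⟨j, rfl⟩ := Nat.exists_eq_add_of_le' hj
  rw [sum_lamZ_mul_AentZ hr hx0 hx1 ε hm hi hiL hjL]
  have hm' : (m : ℝ) ≠ 0 := Int.cast_ne_zero.2 hm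
  have hqa : qint x (dsum r ε (L + 1) * m) ≠ 0 :=
    qint_ne_zero hx0 hx1 (mul_ne_zero (dsum_pos hr ε L).ne' hm')
  have s1 := dsum_succ r ε j
  have s2 := dsum_succ r ε (j + 1)
  have hlow : gamj x r m ε (j + 1) * qint x (dsum r ε j * m) +
      qint x (r * m) * sigmaj x r m ε (j + 1) * qint x (dsum r ε (j + 1) * m) +
      gamj x r m ε (j + 2) * qint x (dsum r ε (j + 2) * m) = 0 := by
    rw [← gamj_mul_qint_add hr hx0 hx1 hm' ε (j + 1) (dsum r ε (j + 1) * m), s2, s1]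
    ring_nf
  have hupp : gamj x r m ε (j + 1) * qint x ((dsum r ε (L + 1) - dsum r ε j) * m) +
      qint x (r * m) * sigmaj x r m ε (j + 1) *
        qint x ((dsum r ε (L + 1) - dsum r ε (j + 1)) * m) +
      gamj x r m ε (j + 2) * qint x ((dsum r ε (L + 1) - dsum r ε (j + 2)) * m) = 0 := by
    have h := gamj_mul_qint_add hr hx0 hx1 hm' ε (j + 1)
      ((dsum r ε (j + 1) - dsum r ε (L + 1)) * m)
    have e0 : (dsum r ε (L + 1) - dsum r ε j) * m =
        -((dsum r ε (j + 1) - dsum r ε (L + 1)) * m - dfun r ε (j + 1) * m) := by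
      rw [s1]; ring
    have e1 : (dsum r ε (L + 1) - dsum r ε (j + 1)) * m =
        -((dsum r ε (j + 1) - dsum r ε (L + 1)) * m) := by ring
    have e2 : (dsum r ε (L + 1) - dsum r ε (j + 2)) * m =
        -((dsum r ε (j + 1) - dsum r ε (L + 1)) * m + dfun r ε (j + 1 + 1) * m) := by
      rw [s2]; ring
    rw [e0, e1, e2, qint_neg, qint_neg, qint_neg]
    linear_combination -h
  have hjump : ∀ s : ℝ, x ^ ((r - dfun r ε 1) * m) * qint x ((dsum r ε (L + 1) - s) * m) +
      x ^ ((r + dsum r ε (L + 1) - dfun r ε 1) * m) * qint x (s * m) =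
      x ^ ((r - dfun r ε 1 + s) * m) * qint x (dsum r ε (L + 1) * m) := fun s => by
    rw [← rpow_mul_qint_add hx0, show r + dsum r ε (L + 1) - dfun r ε 1 =
      r - dfun r ε 1 + dsum r ε (L + 1) by ring]
  rcases lt_trichotomy i (j + 1) with h | h | h
  · have h1 : ¬ j < i := by omega
    have h2 : ¬ j + 1 < i := by omega
    have h3 : ¬ j + 2 < i := by omega
    have h4 : i ≠ j + 1 := by omega
    have h5 : i ≠ j + 1 + 1 := by omega
    simp only [lamCore, if_neg h1, if_neg h2, if_neg h3, qijD, pijD, if_neg h4, if_neg h5]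
    linear_combination (x - x⁻¹) / qint x (dsum r ε (L + 1) * m) *
      x ^ ((r - dfun r ε 1) * m) * hupp
  · subst h
    have hg := qint_mul_sub_inv hx0 hx1 ((r - dfun r ε (j + 1)) * m)
    rw [← gamj_eq] at hg
    rw [qijD_zpow_sub_pijD_zpow_self hx0,
      show (dsum r ε (j + 1) - dfun r ε 1) * m =
        -((r - dfun r ε (j + 1)) * m) + (r - dfun r ε 1 + dsum r ε j) * m by rw [s1]; ring,
      show (2 * r - dfun r ε (j + 1) + dsum r ε j - dfun r ε 1) * m =
        (r - dfun r ε (j + 1)) * m + (r - dfun r ε 1 + dsum r ε j) * m by ring,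
      Real.rpow_add hx0, Real.rpow_add hx0, ← sub_mul,
      ← neg_sub (x ^ ((r - dfun r ε (j + 1)) * m)), ← hg]
    simp only [lamCore, if_pos (by omega : j < j + 1), lt_irrefl, if_false,
      if_neg (by omega : ¬ j + 2 < j + 1)]
    rw [div_mul_eq_mul_div, div_eq_iff hqa]
    linear_combination (x - x⁻¹) * x ^ ((r - dfun r ε 1) * m) * hupp -
      (x - x⁻¹) * gamj x r m ε (j + 1) * hjump (dsum r ε j)
  · rcases eq_or_ne i (j + 2) with rfl | h'
    · have hg := qint_mul_sub_inv hx0 hx1 ((r - dfun r ε (j + 2)) * m)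
      rw [← gamj_eq] at hg
      rw [qijD_zpow_sub_pijD_zpow_succ hx0,
        show (2 * r + dsum r ε (j + 1) - dfun r ε 1) * m =
          (r - dfun r ε (j + 2)) * m + (r - dfun r ε 1 + dsum r ε (j + 2)) * m by
            rw [s2]; ring,
        show (dsum r ε (j + 1) - dfun r ε 1 + 2 * dfun r ε (j + 2)) * m =
          -((r - dfun r ε (j + 2)) * m) + (r - dfun r ε 1 + dsum r ε (j + 2)) * m by
            rw [s2]; ring,
        Real.rpow_add hx0, Real.rpow_add hx0, ← sub_mul, ← hg]
      simp only [lamCore, if_pos (by omega : j < j + 2), if_pos (by omega : j + 1 < j + 2),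
        lt_irrefl, if_false]
      rw [div_mul_eq_mul_div, div_eq_iff hqa]
      linear_combination
        -(x - x⁻¹) * x ^ ((r + dsum r ε (L + 1) - dfun r ε 1) * m) * hlow +
        (x - x⁻¹) * gamj x r m ε (j + 2) * hjump (dsum r ε (j + 2))
    · have h1 : j < i := by omega
      have h2 : j + 1 < i := by omega
      have h3 : j + 2 < i := by omega
      have h4 : i ≠ j + 1 := by omega
      have h5 : i ≠ j + 1 + 1 := h'
      simp only [lamCore, if_pos h1, if_pos h2, if_pos h3, qijD, pijD, if_neg h4, if_neg h5]
      linear_combination -(x - x⁻¹) / qint x (dsum r ε (L + 1) * m) *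
        x ^ ((r + dsum r ε (L + 1) - dfun r ε 1) * m) * hlow

/-- The coefficients (3.14)–(3.15) of Theorem 3.1 solve the mutual-locality linear
system (3.18) of Lemma 3.5: for every nonzero integer `m`, `1 ≤ i ≤ L+1`, `1 ≤ j ≤ L`,
`Σ_{k=1}^{L} λ_{i,k}(m) A_{k,j}(m) s_j(-m) = q_{i,j}^m - p_{i,j}^m`;
in particular the left-hand side vanishes when `i ∉ {j, j+1}`. -/
theorem statement11 (L : ℕ) (hL : 1 ≤ L) (r x : ℝ) (hr : 1 < r) (hx0 : 0 < x) (hx1 : x < 1)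
    (ε : ℕ → Bool) (m : ℤ) (hm : m ≠ 0) :
    ∀ i ∈ Finset.Icc 1 (L + 1), ∀ j ∈ Finset.Icc 1 L,
      (∑ k ∈ Finset.Icc 1 L, lamZ L x r ε i k m * AentZ x r ε m k j * sfun x r ε j (-m)) =
          qijD x r ε i j ^ m - pijD x r ε i j ^ m ∧
        (i ≠ j → i ≠ j + 1 →
          (∑ k ∈ Finset.Icc 1 L, lamZ L x r ε i k m * AentZ x r ε m k j * sfun x r ε j (-m))
            = 0) := by
  intro i hi j hj
  rw [Finset.mem_Icc] at hi hj
  have h := sum_lamZ_mul_AentZ_eq hr hx0 hx1 ε hm hi.1 hi.2 hj.1 hj.2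
  refine ⟨h, fun h1 h2 => ?_⟩
  rw [h]
  simp [qijD, pijD, h1, h2]
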